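/- Let p ≥ 5 be a prime and let ℓ ≥ 2 be an integer with ℓ ≡ 1 (mod 3). Then there exists an integer n with ℓ ≤ n ≤ ℓ(3ℓ+1)/2 such that C̄_{p,1}(n) is even. -/

import Mathlib

/-- Andrews' singular overpartition function `C̄_{k,i}(n)`: the number of pairs `(λ, S)`
where `λ` is a partition of `n` with no part divisible by `k` and `S` is a set of
part-values of `λ`, each congruent to `i` or `-i` modulo `k`. -/
noncomputable def singularOverpartition (k i n : ℕ) : ℕ :=
  Nat.card {P : n.Partition × Finset ℕ //
    (∀ j ∈ P.1.parts, ¬ k ∣ j) ∧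
    P.2 ⊆ P.1.parts.toFinset ∧
    ∀ x ∈ P.2, (x : ZMod k) = (i : ZMod k) ∨ (x : ZMod k) = -(i : ZMod k)}

open PowerSeries Finset

section QBinomial

variable {R : Type*} [CommRing R]

/-- The Gaussian binomial coefficient evaluated at `q`. -/
def gaussBinom (q : R) : ℕ → ℕ → R
  | _, 0 => 1
  | 0, _ + 1 => 0
  | m + 1, j + 1 => q ^ (j + 1) * gaussBinom q m (j + 1) + gaussBinom q m j

/-- The finite `q`-Pochhammer product `(1 - q) (1 - q ^ 2) ⋯ (1 - q ^ m)`. -/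
def qPochhammer (q : R) (m : ℕ) : R := ∏ i ∈ range m, (1 - q ^ (i + 1))

@[simp]
theorem gaussBinom_zero_right (q : R) (m : ℕ) : gaussBinom q m 0 = 1 := by
  cases m <;> rfl

theorem gaussBinom_succ_succ (q : R) (m j : ℕ) :
    gaussBinom q (m + 1) (j + 1) = q ^ (j + 1) * gaussBinom q m (j + 1) + gaussBinom q m j := rfl

theorem gaussBinom_eq_zero_of_lt (q : R) {m j : ℕ} (h : m < j) : gaussBinom q m j = 0 := by
  induction m generalizing j with
  | zero => obtain ⟨j, rfl⟩ := Nat.exists_eq_succ_of_ne_zero h.ne'; rfl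
  | succ m ih =>
    obtain ⟨j, rfl⟩ := Nat.exists_eq_succ_of_ne_zero (Nat.ne_zero_of_lt h)
    rw [gaussBinom_succ_succ, ih (by lia), ih (by lia)]
    simp

@[simp]
theorem gaussBinom_self (q : R) (m : ℕ) : gaussBinom q m m = 1 := by
  induction m with
  | zero => rfl
  | succ m ih => simp [gaussBinom_succ_succ, gaussBinom_eq_zero_of_lt, ih]

theorem qPochhammer_succ (q : R) (m : ℕ) :
    qPochhammer q (m + 1) = qPochhammer q m * (1 - q ^ (m + 1)) :=
  prod_range_succ _ _

theorem gaussBinom_mul_qPochhammer (q : R) (i j : ℕ) :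
    gaussBinom q (i + j) j * (qPochhammer q i * qPochhammer q j) = qPochhammer q (i + j) := by
  induction i generalizing j with
  | zero => simp [qPochhammer]
  | succ i ihi =>
    induction j with
    | zero => simp [qPochhammer]
    | succ j ihj =>
      have h₁ := ihi (j + 1)
      rw [show i + 1 + (j + 1) = (i + 1 + j) + 1 by ring, gaussBinom_succ_succ,
        qPochhammer_succ q (i + 1 + j), ← ihj]
      rw [show i + (j + 1) = i + 1 + j by ring, ← ihj] at h₁
      simp only [qPochhammer_succ] at h₁ ⊢
      linear_combination q ^ (j + 1) * (1 - q ^ (i + 1)) * h₁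

/-- The homogeneous form of the finite `q`-binomial theorem. -/
theorem prod_add_mul_pow (q y z : R) (m : ℕ) :
    ∏ t ∈ range m, (y + z * q ^ t) =
      ∑ j ∈ range (m + 1), q ^ (∑ i ∈ range j, i) * gaussBinom q m j * y ^ (m - j) * z ^ j := by
  induction m generalizing z with
  | zero => simp
  | succ m ih =>
    have h₁ (t : ℕ) : y + z * q ^ (t + 1) = y + (z * q) * q ^ t := by ring
    have h₂ : ∑ j ∈ range (m + 1), q ^ (∑ i ∈ range (j + 1), i) *
        (q ^ (j + 1) * gaussBinom q m (j + 1)) * y ^ (m - j) * z ^ (j + 1) + y ^ (m + 1) =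
        y * ∑ j ∈ range (m + 1),
          q ^ (∑ i ∈ range j, i) * gaussBinom q m j * y ^ (m - j) * (z * q) ^ j := by
      rw [sum_range_succ, gaussBinom_eq_zero_of_lt q (Nat.lt_succ_self m)]
      conv_rhs => rw [sum_range_succ', mul_add, mul_sum]
      simp only [gaussBinom_zero_right, mul_zero, zero_mul, add_zero]
      congr 1
      · refine sum_congr rfl fun j hj => ?_
        rw [show m - j = m - (j + 1) + 1 by grind]
        ring
      · simp [pow_succ']
    rw [prod_range_succ', prod_congr rfl fun t _ => h₁ t, ih, sum_range_succ' _ (m + 1)]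
    simp only [gaussBinom_succ_succ, mul_add (q ^ _), add_mul, sum_add_distrib,
      Nat.add_sub_add_right, range_zero, sum_empty, pow_zero, gaussBinom_zero_right, mul_one, one_mul,
      tsub_zero]
    rw [add_right_comm, h₂, mul_add, mul_comm y, add_right_inj, sum_mul]
    refine sum_congr rfl fun j _ => ?_
    rw [sum_range_succ]
    ring

end QBinomial

section Theta

variable {R : Type*} [CommRing R]

theorem X_pow_dvd_qPochhammer_sub {p : ℕ} (hp : 0 < p) {N u : ℕ} (hu : N ≤ u) :
    (X : R⟦X⟧) ^ (N + 1) ∣ qPochhammer (X ^ p) u - qPochhammer (X ^ p) N := by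
  induction u, hu using Nat.le_induction with
  | base => simp
  | succ u hu ih =>
    have h : (X : R⟦X⟧) ^ (N + 1) ∣ (X ^ p) ^ (u + 1) := by
      rw [← pow_mul]
      exact pow_dvd_pow _ (by nlinarith)
    rw [qPochhammer_succ]
    convert dvd_sub ih (h.mul_left (qPochhammer (X ^ p) u)) using 1
    ring

theorem isUnit_qPochhammer_X_pow {p : ℕ} (hp : 0 < p) (m : ℕ) :
    IsUnit (qPochhammer (X ^ p : R⟦X⟧) m) := by
  rw [PowerSeries.isUnit_iff_constantCoeff]
  simp [qPochhammer, hp.ne']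

theorem X_pow_dvd_gaussBinom_mul_qPochhammer_sub_one {p : ℕ} (hp : 0 < p) {N i j n : ℕ}
    (hi : N ≤ i) (hj : N ≤ j) (hn : N ≤ n) :
    (X : R⟦X⟧) ^ (N + 1) ∣ gaussBinom (X ^ p) (i + j) j * qPochhammer (X ^ p) n - 1 := by
  have hi := X_pow_dvd_qPochhammer_sub (R := R) hp hi
  have hij := X_pow_dvd_qPochhammer_sub (R := R) hp (hj.trans (Nat.le_add_left j i))
  have hj := X_pow_dvd_qPochhammer_sub (R := R) hp hj
  have hn := X_pow_dvd_qPochhammer_sub (R := R) hp hn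
  have h := gaussBinom_mul_qPochhammer (X ^ p : R⟦X⟧) i j
  set e := qPochhammer (X ^ p : R⟦X⟧)
  set g := gaussBinom (X ^ p : R⟦X⟧) (i + j) j
  have he : IsUnit (e N * e N) :=
    (isUnit_qPochhammer_X_pow hp N).mul (isUnit_qPochhammer_X_pow hp N)
  rw [← he.dvd_mul_left]
  have key : e N * e N * (g * e n - 1) =
      (e (i + j) - e N) * e n + (e n - e N) * e N - (e i - e N) * (g * e n * e j)
        - (e j - e N) * (g * e n * e N) := by
    linear_combination e n * h
  rw [key]
  exact (((hij.mul_right _).add (hn.mul_right _)).sub (hi.mul_right _)).sub (hj.mul_right _)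

theorem prod_X_pow_add_X_pow {p : ℕ} (hp : 0 < p) (n : ℕ) :
    ∏ t ∈ range (n + n), ((X : R⟦X⟧) ^ (p * n - 1) + 1 * (X ^ p) ^ t) =
      X ^ (p * (∑ i ∈ range n, i) + (p * n - 1) * n) *
        ∏ t ∈ range n, ((1 + X ^ (p * t + 1)) * (1 + X ^ (p * t + (p - 1)))) := by
  have h₁ : ∏ t ∈ range n, ((X : R⟦X⟧) ^ (p * n - 1) + 1 * (X ^ p) ^ t) =
      X ^ (p * ∑ i ∈ range n, i) * ∏ t ∈ range n, (1 + X ^ (p * t + (p - 1))) := by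
    rw [← prod_range_reflect (fun t => 1 + (X : R⟦X⟧) ^ (p * t + (p - 1))), pow_mul,
      ← prod_pow_eq_pow_sum, ← prod_mul_distrib]
    refine prod_congr rfl fun t ht => ?_
    obtain ⟨d, rfl⟩ : ∃ d, n = t + 1 + d := Nat.exists_eq_add_of_le (mem_range.mp ht)
    rw [show t + 1 + d - 1 - t = d by lia, mul_add (_ ^ _), mul_one, one_mul, ← pow_mul, ← pow_add,
      add_comm (X ^ _)]
    congr 2
    rw [mul_add, mul_add]
    lia
  have h₂ : ∏ t ∈ range n, ((X : R⟦X⟧) ^ (p * n - 1) + 1 * (X ^ p) ^ (n + t)) =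
      X ^ ((p * n - 1) * n) * ∏ t ∈ range n, (1 + X ^ (p * t + 1)) := by
    rw [pow_mul, pow_eq_prod_const _ n, ← prod_mul_distrib]
    refine prod_congr rfl fun t ht => ?_
    have hpn : 0 < p * n := Nat.mul_pos hp (Nat.zero_lt_of_lt (mem_range.mp ht))
    rw [mul_add (_ ^ _), mul_one, one_mul, ← pow_mul, ← pow_add]
    congr 2
    rw [mul_add]
    lia
  rw [prod_range_add, h₁, h₂, prod_mul_distrib, pow_add]
  ring

/-- A coefficient form of the vanishing part of the Jacobi triple product identity. -/
theorem coeff_prod_theta_eq_zero {p : ℕ} (hp : 2 ≤ p) {N n : ℕ} (hn : 2 * N ≤ n)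
    (hN : ∀ k : ℤ, (2 * N : ℤ) ≠ p * (k * (k - 1)) + 2 * k) :
    coeff N ((∏ t ∈ range n, ((1 + (X : R⟦X⟧) ^ (p * t + 1)) * (1 + X ^ (p * t + (p - 1))))) *
      qPochhammer (X ^ p) n) = 0 := by
  have hp0 : 0 < p := by lia
  set A := p * (∑ i ∈ range n, i) + (p * n - 1) * n with hA
  rw [← coeff_X_pow_mul _ A N, ← mul_assoc, ← prod_X_pow_add_X_pow hp0, prod_add_mul_pow, sum_mul,
    map_sum]
  refine sum_eq_zero fun j hj => ?_
  obtain ⟨i, hi⟩ : ∃ i, n + n = i + j := ⟨n + n - j, by grind⟩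
  rw [hi, Nat.add_sub_cancel, one_pow, mul_one, ← pow_mul, ← pow_mul,
    show ∀ a b c d : R⟦X⟧, a * b * c * d = (a * c) * (b * d) by intros; ring, ← pow_add,
    coeff_X_pow_mul']
  split_ifs with hB
  swap
  · rfl
  set B := p * (∑ i ∈ range j, i) + (p * n - 1) * i with hBdef
  rcases Nat.eq_zero_or_pos n with rfl | hn0
  · exact absurd (hN 0) (by simp; lia)
  obtain ⟨k, hk⟩ : ∃ k : ℤ, (j : ℤ) = n + k := ⟨j - n, by ring⟩
  have hik : (i : ℤ) = n - k := by lia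
  have hsum (m : ℕ) : 2 * ((∑ i ∈ range m, i : ℕ) : ℤ) = m * (m - 1) := by
    have := sum_range_id_mul_two m
    cases m with
    | zero => simp
    | succ m =>
      zify at this
      push_cast at this ⊢
      linarith
  have hpn : 1 ≤ p * n := Nat.mul_pos hp0 hn0
  have hBA : (2 * B : ℤ) = 2 * A + (p * (k * (k - 1)) + 2 * k) := by
    rw [hBdef, hA]
    push_cast [Nat.cast_sub hpn]
    have h₁ := hsum j
    have h₂ := hsum n
    push_cast at h₁ h₂
    rw [hik]
    rw [hk] at h₁
    linear_combination (p : ℤ) * h₁ - (p : ℤ) * h₂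
  have hk2 : |k| ≤ N ∧ (A : ℤ) ≤ B := by
    have hB' : (B : ℤ) ≤ A + N := by rw [add_comm]; exact_mod_cast hB
    have hp' : (2 : ℤ) ≤ p := by exact_mod_cast hp
    have hkk : 0 ≤ k * (k - 1) := by
      rcases le_or_gt k 0 with h | h <;> nlinarith
    have h₁ : 2 * (k * (k - 1)) ≤ p * (k * (k - 1)) := by gcongr
    constructor
    · rw [abs_le]
      constructor <;> nlinarith
    · nlinarith [sq_nonneg k]
  obtain ⟨hkN, hAB⟩ := hk2
  rw [abs_le] at hkN
  have hdvd := X_pow_dvd_gaussBinom_mul_qPochhammer_sub_one (R := R) hp0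
    (show N ≤ i by lia) (show N ≤ j by lia) (show N ≤ n by lia)
  rw [X_pow_dvd_iff] at hdvd
  have h := hdvd (N + A - B) (by lia)
  rw [map_sub, coeff_one, if_neg, sub_zero] at h
  · exact h
  · have := hN k
    lia

end Theta

section Parity

open scoped PowerSeries.WithPiTopology

open Classical in
/-- Modulo two, only the partitions without parts in the classes `0`, `i`, `-i` modulo `k`
contribute to the number of singular overpartitions. -/
theorem singularOverpartition_cast_zmod_two (k i n : ℕ) :
    (singularOverpartition k i n : ZMod 2) = coeff n (Nat.Partition.genFun fun j _ =>
      if k ∣ j ∨ (j : ZMod k) = i ∨ (j : ZMod k) = -i then (0 : ZMod 2) else 1) := by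
  have hmem (P : n.Partition) (S : Finset ℕ) :
      (S ∈ if ∀ j ∈ P.parts, ¬ k ∣ j then
        (P.parts.toFinset.filter fun x : ℕ => (x : ZMod k) = i ∨ (x : ZMod k) = -i).powerset else ∅) ↔
      (∀ j ∈ P.parts, ¬ k ∣ j) ∧ S ⊆ P.parts.toFinset ∧
        ∀ x ∈ S, (x : ZMod k) = i ∨ (x : ZMod k) = -i := by
    split_ifs with h
    · simp only [mem_powerset, subset_iff, mem_filter, forall_and]
      tauto
    · simp [h]
  have hfin (P : n.Partition) : Finite {S : Finset ℕ // (∀ j ∈ P.parts, ¬ k ∣ j) ∧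
      S ⊆ P.parts.toFinset ∧ ∀ x ∈ S, (x : ZMod k) = i ∨ (x : ZMod k) = -i} :=
    Finite.of_equiv _ (Equiv.subtypeEquivRight (hmem P))
  rw [singularOverpartition, Nat.card_congr (Equiv.subtypeProdEquivSigmaSubtype
    fun (P : n.Partition) (S : Finset ℕ) => (∀ j ∈ P.parts, ¬ k ∣ j) ∧
      S ⊆ P.parts.toFinset ∧ ∀ x ∈ S, (x : ZMod k) = i ∨ (x : ZMod k) = -i), Nat.card_sigma,
    Nat.Partition.coeff_genFun, Nat.cast_sum]
  refine sum_congr rfl fun P _ => ?_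
  rw [Nat.subtype_card _ (hmem P), Finsupp.prod, Multiset.toFinsupp_support]
  by_cases h : ∃ j ∈ P.parts, k ∣ j ∨ (j : ZMod k) = i ∨ (j : ZMod k) = -i
  · obtain ⟨j, hj, hjk⟩ := h
    refine Eq.trans ?_ (prod_eq_zero (Multiset.mem_toFinset.mpr hj) (by exact if_pos hjk)).symm
    split_ifs with hdvd
    · rw [card_powerset, Nat.cast_pow, show ((2 : ℕ) : ZMod 2) = 0 from rfl, zero_pow]
      exact card_ne_zero_of_mem (mem_filter.mpr
        ⟨Multiset.mem_toFinset.mpr hj, hjk.resolve_left (hdvd j hj)⟩)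
    · simp
  · push Not at h
    rw [if_pos fun j hj => (h j hj).1, filter_eq_empty_iff.mpr, prod_congr rfl fun j hj => if_neg _]
    · simp
    · intro j hj
      have := h j (Multiset.mem_toFinset.mp hj)
      tauto
    · intro j hj
      have := h j (Multiset.mem_toFinset.mp hj)
      tauto

theorem hasProd_genFun_mul_pentagonalSeries {R : Type*} [CommRing R] [TopologicalSpace R]
    [IsTopologicalRing R] [T2Space R] (s : ℕ → Prop) [DecidablePred s] :
    HasProd (fun i => if s (i + 1) then 1 - (X : R⟦X⟧) ^ (i + 1) else 1)
      (Nat.Partition.genFun (fun j _ => if s j then (0 : R) else 1) * pentagonalSeries R) := by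
  convert! (Nat.Partition.hasProd_genFun fun j _ => if s j then (0 : R) else 1).mul
    (WithPiTopology.hasProd_one_sub_X_pow R) using 2 with i
  split_ifs with h
  · simp
  · have hs := Nat.Partition.summable_genFun_term (fun _ _ => (1 : R)) i
    have hgeom := WithPiTopology.tsum_pow_mul_one_sub_of_constantCoeff_eq_zero
      (f := (X : R⟦X⟧) ^ (i + 1)) (by simp)
    simp only [one_smul, pow_mul] at hs ⊢
    rw [tsum_eq_zero_add' hs, pow_zero] at hgeom
    exact hgeom.symm

theorem natCast_zmod_block_iff {p : ℕ} (hp : 3 ≤ p) (n : ℕ) {r : ℕ} (hr : r < p) :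
    (p ∣ p * n + r + 1 ∨ ((p * n + r + 1 : ℕ) : ZMod p) = (1 : ℕ) ∨
      ((p * n + r + 1 : ℕ) : ZMod p) = -(1 : ℕ)) ↔ r = 0 ∨ r = p - 2 ∨ r = p - 1 := by
  have h₁ : p ∣ p * n + r + 1 ↔ r = p - 1 := by
    rw [add_assoc, Nat.dvd_add_right (Nat.dvd_mul_right p n)]
    refine ⟨fun h => ?_, fun h => ⟨1, by lia⟩⟩
    have := Nat.le_of_dvd (by lia) h
    lia
  have h₂ : ((p * n + r + 1 : ℕ) : ZMod p) = (1 : ℕ) ↔ r = 0 := by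
    push_cast
    rw [CharP.cast_eq_zero, zero_mul, zero_add, add_eq_right, ZMod.natCast_eq_zero_iff]
    exact ⟨fun h => Nat.eq_zero_of_dvd_of_lt h hr, fun h => h ▸ dvd_zero p⟩
  have h₃ : ((p * n + r + 1 : ℕ) : ZMod p) = -(1 : ℕ) ↔ r = p - 2 := by
    rw [eq_neg_iff_add_eq_zero, ← Nat.cast_add, ZMod.natCast_eq_zero_iff, add_assoc, add_assoc,
      Nat.dvd_add_right (Nat.dvd_mul_right p n)]
    refine ⟨fun h => ?_, fun h => ⟨1, by lia⟩⟩
    obtain ⟨c, hc⟩ := h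
    have : c = 1 := by
      have : 0 < c := Nat.pos_of_ne_zero (by rintro rfl; simp at hc)
      have : c < 2 := by by_contra! h; nlinarith
      lia
    subst this
    lia
  rw [h₁, h₂, h₃]
  tauto

open Classical in
theorem prod_range_mul_block {R : Type*} [CommRing R] {p : ℕ} (hp : 3 ≤ p) (n : ℕ) :
    ∏ i ∈ range (p * n), (if p ∣ i + 1 ∨ ((i + 1 : ℕ) : ZMod p) = (1 : ℕ) ∨
      ((i + 1 : ℕ) : ZMod p) = -(1 : ℕ) then 1 - (X : R⟦X⟧) ^ (i + 1) else 1) =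
    (∏ t ∈ range n, ((1 - X ^ (p * t + 1)) * (1 - X ^ (p * t + (p - 1))))) *
      qPochhammer (X ^ p) n := by
  induction n with
  | zero => simp [qPochhammer]
  | succ n ih =>
    rw [mul_add_one, prod_range_add, ih, prod_range_succ, qPochhammer_succ]
    have h : ∏ r ∈ range p, (if p ∣ p * n + r + 1 ∨ ((p * n + r + 1 : ℕ) : ZMod p) = (1 : ℕ) ∨
        ((p * n + r + 1 : ℕ) : ZMod p) = -(1 : ℕ) then 1 - (X : R⟦X⟧) ^ (p * n + r + 1) else 1) =
        ∏ r ∈ {0, p - 2, p - 1}, (1 - (X : R⟦X⟧) ^ (p * n + r + 1)) := by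
      rw [prod_congr rfl fun r hr =>
        if_congr (natCast_zmod_block_iff hp n (mem_range.mp hr)) rfl rfl, ← prod_filter]
      congr 1
      ext r
      simp only [mem_filter, mem_range, mem_insert, mem_singleton]
      lia
    rw [h, prod_insert (by simp; lia), prod_pair (by lia),
      show p * n + (p - 2) + 1 = p * n + (p - 1) by lia,
      show p * n + (p - 1) + 1 = p * (n + 1) by rw [mul_add_one]; lia, ← pow_mul]
    ring

open Classical in
theorem coeff_genFun_mul_pentagonalSeries_eq_zero {p : ℕ} (hp : 3 ≤ p) {N : ℕ}
    (hN : ∀ k : ℤ, (2 * N : ℤ) ≠ p * (k * (k - 1)) + 2 * k) :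
    coeff N ((Nat.Partition.genFun fun j _ =>
      if p ∣ j ∨ (j : ZMod p) = (1 : ℕ) ∨ (j : ZMod p) = -(1 : ℕ) then (0 : ZMod 2) else 1) *
        pentagonalSeries (ZMod 2)) = 0 := by
  let : TopologicalSpace (ZMod 2) := ⊥
  have : DiscreteTopology (ZMod 2) := ⟨rfl⟩
  have h := (hasProd_genFun_mul_pentagonalSeries (R := ZMod 2) fun j =>
    p ∣ j ∨ (j : ZMod p) = (1 : ℕ) ∨ (j : ZMod p) = -(1 : ℕ)).tendsto_prod_nat
  have h := (WithPiTopology.tendsto_iff_coeff_tendsto _ _ _ _).mp h N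
  have h := h.comp (Filter.tendsto_id.const_mul_atTop' (show 0 < p by lia))
  refine tendsto_nhds_unique h (tendsto_atTop_of_eventually_const (i₀ := 2 * N) fun n hn => ?_)
  have hneg (f : (ZMod 2)⟦X⟧) : 1 - f = 1 + f := by
    rw [sub_eq_add_neg, add_right_inj]
    ext m
    rw [map_neg, CharTwo.neg_eq]
  simp only [Function.comp_apply, id]
  rw [prod_range_mul_block hp]
  simp only [hneg (X ^ (p * _ + _))]
  exact coeff_prod_theta_eq_zero (by lia) hn hN

theorem coeff_mul_pentagonalSeries {R : Type*} [CommRing R] (f : R⟦X⟧) (ℓ : ℕ) :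
    coeff (pentagonal (-ℓ)) (f * pentagonalSeries R) =
      ∑ k ∈ Icc (-ℓ : ℤ) ℓ, coeff (pentagonal (-ℓ) - pentagonal k) f * Int.negOnePow k := by
  have hle {k : ℤ} : k ∈ Icc (-ℓ : ℤ) ℓ ↔ pentagonal k ≤ pentagonal (-ℓ) := by
    rw [mem_Icc]
    zify
    have h₁ := two_mul_natCast_pentagonal k
    have h₂ := two_mul_natCast_pentagonal (-ℓ)
    constructor
    · rintro ⟨h₃, h₄⟩
      nlinarith
    · intro h
      constructor
      · by_contra! h'
        nlinarith
      · by_contra! h'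
        nlinarith
  rw [mul_comm, coeff_mul, Nat.sum_antidiagonal_eq_sum_range_succ
    (fun a b => coeff a (pentagonalSeries R) * coeff b f)]
  symm
  refine sum_of_injOn pentagonal pentagonal_injective.injOn ?_ ?_ ?_
  · intro k hk
    have := hle.mp (mem_coe.mp hk)
    simpa [Nat.lt_succ_iff] using this
  · intro b hb hb'
    rw [coeff_pentagonalSeries_eq_zero, zero_mul]
    rintro ⟨k, rfl⟩
    exact hb' ⟨k, mem_coe.mpr (hle.mpr (Nat.lt_succ_iff.mp (mem_range.mp hb))), rfl⟩
  · intro k _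
    rw [coeff_pentagonalSeries_pentagonal, mul_comm]

theorem not_represented_of_mod_three {p N : ℕ} (hp : ¬ 3 ∣ p) (hN : N % 3 = 2) (k : ℤ) :
    (2 * N : ℤ) ≠ p * (k * (k - 1)) + 2 * k := by
  intro h
  have h₃ : ((2 * N : ℤ) : ZMod 3) = ((p * (k * (k - 1)) + 2 * k : ℤ) : ZMod 3) := by rw [h]
  push_cast at h₃
  have hN' : (N : ZMod 3) = 2 := by
    rw [← Nat.mod_add_div N 3, hN]
    push_cast
    rw [show (3 : ZMod 3) = 0 from rfl]
    simp
  have hp' : (p : ZMod 3) ≠ 0 := by rwa [Ne, ZMod.natCast_eq_zero_iff]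
  rw [hN'] at h₃
  generalize (p : ZMod 3) = a at *
  generalize (k : ZMod 3) = b at *
  revert a b
  decide

end Parity

theorem stmt_9 (p : ℕ) (hp : p.Prime) (hp5 : 5 ≤ p) (ℓ : ℕ) (hℓ : 2 ≤ ℓ) (hℓmod : ℓ % 3 = 1) :
    ∃ n : ℕ, ℓ ≤ n ∧ n ≤ ℓ * (3 * ℓ + 1) / 2 ∧ Even (singularOverpartition p 1 n) := by
  classical
  by_contra! hodd
  have hpent : ℓ * (3 * ℓ + 1) / 2 = pentagonal (-ℓ) := by
    rw [pentagonal_neg]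
    norm_cast
  have h₂ := two_mul_natCast_pentagonal_neg ℓ
  rw [hpent] at hodd
  have hmod : pentagonal (-ℓ) % 3 = 2 := by
    obtain ⟨m, rfl⟩ : ∃ m, ℓ = 3 * m + 1 := ⟨ℓ / 3, by lia⟩
    have : 2 * pentagonal (-(3 * m + 1 : ℕ)) = 3 * (9 * (m * m) + 7 * m + 1) + 1 := by
      zify
      push_cast at h₂
      rw [h₂]
      ring
    lia
  have hp3 : ¬ 3 ∣ p := fun h => by
    have := (Nat.prime_dvd_prime_iff_eq Nat.prime_three hp).mp h
    lia
  have hzero := coeff_genFun_mul_pentagonalSeries_eq_zero (show 3 ≤ p by lia)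
    (not_represented_of_mod_three hp3 hmod)
  rw [coeff_mul_pentagonalSeries] at hzero
  have hone : ∀ k ∈ Icc (-ℓ : ℤ) ℓ, coeff (pentagonal (-ℓ) - pentagonal k)
      (Nat.Partition.genFun fun j _ => if p ∣ j ∨ (j : ZMod p) = (1 : ℕ) ∨
        (j : ZMod p) = -(1 : ℕ) then (0 : ZMod 2) else 1) * (Int.negOnePow k : ZMod 2) = 1 := by
    intro k hk
    have hsign : (Int.negOnePow k : ZMod 2) = 1 := by
      rcases Int.units_eq_one_or (Int.negOnePow k) with h | h <;> rw [h] <;> rfl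
    rw [hsign, mul_one]
    rcases (mem_Icc.mp hk).1.eq_or_lt with rfl | hlt
    · rw [Nat.sub_self, Nat.Partition.coeff_genFun]
      simp
    · have hk₂ := two_mul_natCast_pentagonal k
      have hle : pentagonal k + ℓ ≤ pentagonal (-ℓ) := by
        zify
        have := (mem_Icc.mp hk).2
        nlinarith
      rw [← singularOverpartition_cast_zmod_two, ZMod.natCast_eq_one_iff_odd]
      exact Nat.not_even_iff_odd.mp (hodd _ (by lia) (Nat.sub_le _ _))
  rw [sum_congr rfl hone, sum_const, nsmul_one, Int.card_Icc,
    show ((ℓ : ℤ) + 1 - -ℓ).toNat = 2 * ℓ + 1 by lia] at hzero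
  push_cast at hzero
  rw [show (2 : ZMod 2) = 0 from rfl, zero_mul, zero_add] at hzero
  exact one_ne_zero hzero
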